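/- For every natural number m there exists a constant C_m > 0 such that for every natural number j, all natural numbers k, ℓ with k + ℓ ≤ m, and every x ∈ ℝ, the Hermite function φ_j(x) = (2ʲ · j! · √π)^{−1/2} · H_j(x) · e^{−x²/2} satisfies |x^ℓ · (d/dx)^k φ_j(x)| ≤ C_m · (2j + 1)^{(m+1)/2}. -/

import Mathlib

/-- The physicists' Hermite polynomials: `H₀ = 1`, `H₁ = 2x`,
`H_{n+2} = 2x·H_{n+1} − 2(n+1)·Hₙ`. -/
noncomputable def physHermite : ℕ → Polynomial ℝ
  | 0 => 1
  | 1 => Polynomial.C 2 * Polynomial.X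
  | n + 2 => Polynomial.C 2 * Polynomial.X * physHermite (n + 1)
      - Polynomial.C (2 * ((n : ℝ) + 1)) * physHermite n

/-- The normalized Hermite function `φₙ(x) = (2ⁿ n! √π)^{−1/2} Hₙ(x) e^{−x²/2}`. -/
noncomputable def hermiteFun (n : ℕ) (x : ℝ) : ℝ :=
  ((2 : ℝ) ^ n * (n.factorial : ℝ) * Real.sqrt Real.pi) ^ (-(1 : ℝ) / 2)
    * (physHermite n).eval x * Real.exp (-x ^ 2 / 2)

open Polynomial Filter Topology in
/-- A polynomial times the Gaussian `e^{-x²/2}` vanishes at infinity. -/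
theorem Polynomial.tendsto_eval_mul_gaussian (p : ℝ[X]) :
    Tendsto (fun x : ℝ => p.eval x * Real.exp (-x ^ 2 / 2)) atTop (𝓝 0) := by
  refine squeeze_zero_norm' ?_ (by simpa [abs_div] using p.tendsto_div_exp_atTop.norm)
  filter_upwards [eventually_ge_atTop (2 : ℝ)] with x hx
  rw [norm_mul, Real.norm_eq_abs, Real.norm_eq_abs, Real.abs_exp, div_eq_mul_inv |p.eval x|,
    ← Real.exp_neg]
  refine mul_le_mul_of_nonneg_left ?_ (abs_nonneg _)
  exact Real.exp_le_exp.mpr (by nlinarith)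

open Set Filter Topology in
/-- A solution of `f'' = (x² - a) f` that vanishes at infinity is controlled on `[0, ∞)` by its
energy at the origin. -/
theorem abs_le_of_oscillator_ode {f g : ℝ → ℝ} {a : ℝ} (ha : 1 ≤ a)
    (hf : ∀ x, HasDerivAt f (g x) x) (hg : ∀ x, HasDerivAt g ((x ^ 2 - a) * f x) x)
    (hlim : Tendsto f atTop (𝓝 0)) {x : ℝ} (hx : 0 ≤ x) :
    |f x| ≤ 2 * √(g 0 ^ 2 + a * f 0 ^ 2) := by
  set M := √(g 0 ^ 2 + a * f 0 ^ 2) with hM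
  have hM0 : 0 ≤ M := Real.sqrt_nonneg _
  have hMsq : M ^ 2 = g 0 ^ 2 + a * f 0 ^ 2 := Real.sq_sqrt (by positivity)
  have energy : ∀ y, 0 ≤ y → g y ^ 2 + (a - y ^ 2) * f y ^ 2 ≤ M ^ 2 := by
    have hE : ∀ y, HasDerivAt (fun y => g y ^ 2 + (a - y ^ 2) * f y ^ 2)
        (-(2 * y * f y ^ 2)) y := fun y => by
      refine (((hg y).pow 2).add
        (((hasDerivAt_id y).pow 2).const_sub a |>.mul ((hf y).pow 2))).congr_deriv ?_
      simp
      ring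
    have hanti : AntitoneOn (fun y => g y ^ 2 + (a - y ^ 2) * f y ^ 2) (Ici 0) :=
      antitoneOn_of_deriv_nonpos (convex_Ici 0)
        (fun y _ => (hE y).continuousAt.continuousWithinAt)
        (fun y _ => (hE y).differentiableAt.differentiableWithinAt)
        (fun y hy => by
          rw [interior_Ici] at hy
          have : (0 : ℝ) < y := hy
          rw [(hE y).deriv]
          nlinarith [mul_nonneg this.le (sq_nonneg (f y))])
    intro y hy
    have := hanti (mem_Ici.mpr le_rfl) (mem_Ici.mpr hy) hy
    simp only at this
    rw [hMsq]
    nlinarith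
  have inner : ∀ y, 0 ≤ y → y ^ 2 ≤ a - 1 → |f y| ≤ M := fun y hy hya => by
    refine abs_le_of_sq_le_sq ?_ hM0
    nlinarith [energy y hy, sq_nonneg (g y), mul_nonneg (sub_nonneg.mpr hya) (sq_nonneg (f y))]
  have middle : ∀ y, 0 ≤ y → y ^ 2 ≤ a → |f y| ≤ 2 * M := fun y hy hya => by
    rcases le_total (y ^ 2) (a - 1) with h | h
    · linarith [inner y hy h]
    set z := √(a - 1) with hz
    have hz0 : 0 ≤ z := Real.sqrt_nonneg _
    have hzsq : z ^ 2 = a - 1 := Real.sq_sqrt (by linarith)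
    have hzy : z ≤ y := by nlinarith
    have hyz : y - z ≤ 1 := by nlinarith
    have hgM : ∀ t ∈ Icc z y, ‖g t‖ ≤ M := fun t ht => by
      have ht0 : 0 ≤ t := hz0.trans ht.1
      have hta : t ^ 2 ≤ a := by nlinarith [ht.2]
      refine abs_le_of_sq_le_sq ?_ hM0
      nlinarith [energy t ht0, mul_nonneg (sub_nonneg.mpr hta) (sq_nonneg (f t))]
    have hdiff := (convex_Icc z y).norm_image_sub_le_of_norm_hasDerivWithin_le
      (fun t _ => (hf t).hasDerivWithinAt) hgM (left_mem_Icc.mpr hzy) (right_mem_Icc.mpr hzy)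
    have hfz := inner z hz0 hzsq.le
    rw [Real.norm_eq_abs, Real.norm_eq_abs, abs_of_nonneg (sub_nonneg.mpr hzy)] at hdiff
    have : |f y| ≤ |f y - f z| + |f z| := by simpa using abs_add_le (f y - f z) (f z)
    nlinarith
  rcases le_total (x ^ 2) a with h | h
  · exact middle x hx h
  set r := √a with hr
  have hr0 : 0 ≤ r := Real.sqrt_nonneg _
  have hrsq : r ^ 2 = a := Real.sq_sqrt (by linarith)
  have hrx : r ≤ x := by nlinarith
  have hfg : ∀ y, HasDerivAt (fun y => f y * g y) (g y ^ 2 + (y ^ 2 - a) * f y ^ 2) y :=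
    fun y => ((hf y).mul (hg y)).congr_deriv (by ring)
  have hmono : MonotoneOn (fun y => f y * g y) (Ici r) :=
    monotoneOn_of_deriv_nonneg (convex_Ici r)
      (fun y _ => (hfg y).continuousAt.continuousWithinAt)
      (fun y _ => (hfg y).differentiableAt.differentiableWithinAt)
      (fun y hy => by
        rw [interior_Ici] at hy
        have hry : r < y := hy
        rw [(hfg y).deriv]
        have : 0 ≤ y ^ 2 - a := by nlinarith
        positivity)
  have hsq : ∀ y, HasDerivAt (fun y => f y ^ 2) (2 * (f y * g y)) y :=
    fun y => ((hf y).pow 2).congr_deriv (by simp; ring)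
  have hneg : ∀ y, r ≤ y → f y * g y ≤ 0 := by
    intro y hy
    by_contra! hpos
    have hgrow : MonotoneOn (fun y => f y ^ 2) (Ici y) :=
      monotoneOn_of_deriv_nonneg (convex_Ici y)
        (fun t _ => (hsq t).continuousAt.continuousWithinAt)
        (fun t _ => (hsq t).differentiableAt.differentiableWithinAt)
        (fun t ht => by
          rw [interior_Ici] at ht
          have hyt : y < t := ht
          rw [(hsq t).deriv]
          have := hmono (mem_Ici.mpr hy) (mem_Ici.mpr (hy.trans hyt.le)) hyt.le
          simp only at this
          linarith)
    have hle : f y ^ 2 ≤ 0 := by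
      refine ge_of_tendsto (by simpa using hlim.pow 2) ?_
      filter_upwards [eventually_ge_atTop y] with t ht
      exact hgrow (mem_Ici.mpr le_rfl) (mem_Ici.mpr ht) ht
    have : f y = 0 := by simpa using le_antisymm hle (sq_nonneg _)
    simp [this] at hpos
  have hdecay : AntitoneOn (fun y => f y ^ 2) (Ici r) :=
    antitoneOn_of_deriv_nonpos (convex_Ici r)
      (fun y _ => (hsq y).continuousAt.continuousWithinAt)
      (fun y _ => (hsq y).differentiableAt.differentiableWithinAt)
      (fun y hy => by
        rw [interior_Ici] at hy
        rw [(hsq y).deriv]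
        have := hneg y (le_of_lt hy)
        linarith)
  exact (sq_le_sq.mp (hdecay (mem_Ici.mpr le_rfl) (mem_Ici.mpr hrx) hrx)).trans
    (middle r hr0 hrsq.le)

open Polynomial in
theorem derivative_physHermite_succ (n : ℕ) :
    derivative (physHermite (n + 1)) = C (2 * ((n : ℝ) + 1)) * physHermite n := by
  induction n using Nat.twoStepInduction with
  | zero => simp [physHermite]
  | one => simp [physHermite]; ring
  | more n ih₀ ih₁ =>
    rw [physHermite]
    simp only [derivative_sub, derivative_mul, derivative_C, derivative_X, ih₀, ih₁]
    rw [physHermite]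
    simp only [C_mul, C_add, Nat.cast_add, Nat.cast_one, Nat.cast_ofNat, C_1]
    have : (C (2 : ℝ) : ℝ[X]) = 2 := rfl
    rw [this]
    ring

open Polynomial in
theorem physHermite_succ (n : ℕ) :
    physHermite (n + 1) = C 2 * X * physHermite n - derivative (physHermite n) := by
  cases n with
  | zero => simp [physHermite]
  | succ n => rw [derivative_physHermite_succ, physHermite]

theorem physHermite_eval_neg (n : ℕ) (x : ℝ) :
    (physHermite n).eval (-x) = (-1) ^ n * (physHermite n).eval x := by
  induction n using Nat.twoStepInduction with
  | zero => simp [physHermite]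
  | one => simp [physHermite]
  | more n ih₀ ih₁ =>
    simp only [physHermite, Polynomial.eval_sub, Polynomial.eval_mul, Polynomial.eval_C,
      Polynomial.eval_X, ih₀, ih₁]
    ring

theorem abs_hermiteFun_neg (n : ℕ) (x : ℝ) : |hermiteFun n (-x)| = |hermiteFun n x| := by
  simp [hermiteFun, physHermite_eval_neg, abs_mul]

theorem hermiteFun_tendsto_atTop (n : ℕ) :
    Filter.Tendsto (hermiteFun n) Filter.atTop (nhds 0) := by
  have h := (physHermite n).tendsto_eval_mul_gaussian.const_mul
    (((2 : ℝ) ^ n * (n.factorial : ℝ) * Real.sqrt Real.pi) ^ (-(1 : ℝ) / 2))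
  rw [mul_zero] at h
  exact h.congr fun x => (mul_assoc _ _ _).symm

theorem hermiteFun_normalization_succ (n : ℕ) :
    ((2 : ℝ) ^ n * (n.factorial : ℝ) * √Real.pi) ^ (-(1 : ℝ) / 2) =
      √(2 * ((n : ℝ) + 1)) *
        ((2 : ℝ) ^ (n + 1) * ((n + 1).factorial : ℝ) * √Real.pi) ^ (-(1 : ℝ) / 2) := by
  have hs : 0 < 2 * ((n : ℝ) + 1) := by positivity
  have h : (2 : ℝ) ^ (n + 1) * ((n + 1).factorial : ℝ) * √Real.pi =
      2 * ((n : ℝ) + 1) * ((2 : ℝ) ^ n * (n.factorial : ℝ) * √Real.pi) := by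
    rw [Nat.factorial_succ]
    push_cast
    ring
  rw [h, Real.mul_rpow hs.le (by positivity), ← mul_assoc,
    Real.sqrt_eq_rpow (2 * ((n : ℝ) + 1)), ← Real.rpow_add hs]
  norm_num

theorem hasDerivAt_hermiteFun (n : ℕ) (x : ℝ) :
    HasDerivAt (hermiteFun n) (x * hermiteFun n x - √(2 * ((n : ℝ) + 1)) * hermiteFun (n + 1) x)
      x := by
  have hexp : HasDerivAt (fun x : ℝ => Real.exp (-x ^ 2 / 2)) (Real.exp (-x ^ 2 / 2) * -x) x := by
    refine HasDerivAt.exp ?_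
    refine (((hasDerivAt_id x).pow 2).neg.div_const 2).congr_deriv ?_
    simp
    ring
  refine ((((physHermite n).hasDerivAt x).const_mul _).mul hexp).congr_deriv ?_
  simp only [hermiteFun]
  rw [physHermite_succ, hermiteFun_normalization_succ]
  simp only [Polynomial.eval_sub, Polynomial.eval_mul, Polynomial.eval_C, Polynomial.eval_X]
  ring

theorem sqrt_two_mul_hermiteFun_add_two (n : ℕ) (x : ℝ) :
    √(2 * ((n : ℝ) + 2)) * hermiteFun (n + 2) x =
      2 * x * hermiteFun (n + 1) x - √(2 * ((n : ℝ) + 1)) * hermiteFun n x := by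
  have h₁ := hermiteFun_normalization_succ n
  have h₂ := hermiteFun_normalization_succ (n + 1)
  have hs : √(2 * ((n : ℝ) + 1)) * √(2 * ((n : ℝ) + 1)) = 2 * ((n : ℝ) + 1) :=
    Real.mul_self_sqrt (by positivity)
  have hcast : ((n + 1 : ℕ) : ℝ) + 1 = (n : ℝ) + 2 := by push_cast; ring
  rw [hcast] at h₂
  simp only [hermiteFun, physHermite, Polynomial.eval_sub, Polynomial.eval_mul, Polynomial.eval_C,
    Polynomial.eval_X]
  rw [← mul_assoc, ← mul_assoc, ← h₂, h₁]
  linear_combination (((2 : ℝ) ^ (n + 1) * ((n + 1).factorial : ℝ) * √Real.pi) ^ (-(1 : ℝ) / 2) *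
    (physHermite n).eval x * Real.exp (-x ^ 2 / 2)) * hs

theorem sqrt_two_mul_hermiteFun_one (x : ℝ) :
    √2 * hermiteFun 1 x = 2 * x * hermiteFun 0 x := by
  have h := hermiteFun_normalization_succ 0
  simp only [Nat.cast_zero, zero_add, mul_one] at h
  simp only [hermiteFun]
  rw [h, physHermite, physHermite]
  simp only [Polynomial.eval_mul, Polynomial.eval_C, Polynomial.eval_X, Polynomial.eval_one]
  ring

theorem sqrt_half_eq (a : ℝ) : √(a / 2) = √(2 * a) / 2 := by
  rw [show a / 2 = 2 * a / 2 ^ 2 by ring, Real.sqrt_div' _ (by positivity),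
    Real.sqrt_sq (by positivity)]

theorem mul_hermiteFun (n : ℕ) (x : ℝ) :
    x * hermiteFun n x =
      √((n : ℝ) / 2) * hermiteFun (n - 1) x + √(((n : ℝ) + 1) / 2) * hermiteFun (n + 1) x := by
  rw [sqrt_half_eq, sqrt_half_eq]
  cases n with
  | zero =>
    have := sqrt_two_mul_hermiteFun_one x
    simp
    linarith
  | succ n =>
    have := sqrt_two_mul_hermiteFun_add_two n x
    rw [show ((n + 1 : ℕ) : ℝ) = (n : ℝ) + 1 by push_cast; ring,
      show (n : ℝ) + 1 + 1 = (n : ℝ) + 2 by ring]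
    simp only [Nat.add_sub_cancel]
    linarith

theorem deriv_hermiteFun (n : ℕ) :
    deriv (hermiteFun n) = fun x =>
      √((n : ℝ) / 2) * hermiteFun (n - 1) x - √(((n : ℝ) + 1) / 2) * hermiteFun (n + 1) x := by
  ext x
  rw [(hasDerivAt_hermiteFun n x).deriv, mul_hermiteFun n x, sqrt_half_eq ((n : ℝ) + 1)]
  ring

theorem contDiff_hermiteFun (n : ℕ) {k : WithTop ℕ∞} : ContDiff ℝ k (hermiteFun n) := by
  unfold hermiteFun
  have := (physHermite n).contDiff_aeval (𝕜 := ℝ) k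
  simp only [Polynomial.coe_aeval_eq_eval] at this
  fun_prop

theorem hasDerivAt_deriv_hermiteFun (n : ℕ) (x : ℝ) :
    HasDerivAt (deriv (hermiteFun n)) ((x ^ 2 - (2 * (n : ℝ) + 1)) * hermiteFun n x) x := by
  have hderiv : deriv (hermiteFun n) = fun x =>
      x * hermiteFun n x - √(2 * ((n : ℝ) + 1)) * hermiteFun (n + 1) x := by
    ext x
    exact (hasDerivAt_hermiteFun n x).deriv
  have hs : √(2 * ((n : ℝ) + 1)) * √(2 * ((n : ℝ) + 1)) = 2 * ((n : ℝ) + 1) :=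
    Real.mul_self_sqrt (by positivity)
  have hsucc := sqrt_two_mul_hermiteFun_add_two n x
  have hcast : ((n + 1 : ℕ) : ℝ) + 1 = (n : ℝ) + 2 := by push_cast; ring
  rw [hderiv]
  refine (((hasDerivAt_id x).mul (hasDerivAt_hermiteFun n x)).sub
    ((hasDerivAt_hermiteFun (n + 1) x).const_mul _)).congr_deriv ?_
  rw [hcast, hsucc]
  simp only [id]
  linear_combination (-hermiteFun n x) * hs

theorem abs_hermiteFun_zero_le (n : ℕ) : |hermiteFun n 0| ≤ 1 := by
  induction n using Nat.twoStepInduction with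
  | zero =>
    have hpi : 1 ≤ √Real.pi := Real.one_le_sqrt.mpr (by linarith [Real.pi_gt_three])
    simp only [hermiteFun, physHermite]
    simp
    rw [abs_of_nonneg (by positivity)]
    exact Real.rpow_le_one_of_one_le_of_nonpos hpi (by norm_num)
  | one => simp [hermiteFun, physHermite]
  | more n ih _ =>
    have h := sqrt_two_mul_hermiteFun_add_two n 0
    have h' := congrArg abs h
    simp only [mul_zero, zero_mul, zero_sub, abs_neg, abs_mul, abs_of_nonneg (Real.sqrt_nonneg _)]
      at h'
    have hpos : 0 < √(2 * ((n : ℝ) + 2)) := Real.sqrt_pos.mpr (by positivity)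
    have hle : √(2 * ((n : ℝ) + 1)) ≤ √(2 * ((n : ℝ) + 2)) := Real.sqrt_le_sqrt (by linarith)
    refine le_of_mul_le_mul_left ?_ hpos
    rw [h', mul_one]
    exact (mul_le_of_le_one_right (Real.sqrt_nonneg _) ih).trans hle

theorem abs_hermiteFun_le (n : ℕ) (x : ℝ) :
    |hermiteFun n x| ≤ 4 * √(2 * (n : ℝ) + 1) := by
  have hn : (0 : ℝ) ≤ n := n.cast_nonneg
  have henergy : √(deriv (hermiteFun n) 0 ^ 2 + (2 * (n : ℝ) + 1) * hermiteFun n 0 ^ 2) ≤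
      2 * √(2 * (n : ℝ) + 1) := by
    rw [Real.sqrt_le_left (by positivity), mul_pow, Real.sq_sqrt (by positivity)]
    have hd : deriv (hermiteFun n) 0 ^ 2 ≤ 2 * ((n : ℝ) + 1) := by
      rw [(hasDerivAt_hermiteFun n 0).deriv, zero_mul, zero_sub, neg_sq, mul_pow,
        Real.sq_sqrt (by positivity)]
      exact mul_le_of_le_one_right (by positivity)
        ((sq_le_one_iff_abs_le_one _).mpr (abs_hermiteFun_zero_le (n + 1)))
    have h0 := (sq_le_one_iff_abs_le_one _).mpr (abs_hermiteFun_zero_le n)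
    nlinarith
  have hnonneg : ∀ y, 0 ≤ y → |hermiteFun n y| ≤ 4 * √(2 * (n : ℝ) + 1) := fun y hy => by
    have := abs_le_of_oscillator_ode (a := 2 * (n : ℝ) + 1) (by linarith)
      (fun x => ((contDiff_hermiteFun n (k := 1)).differentiable one_ne_zero x).hasDerivAt)
      (hasDerivAt_deriv_hermiteFun n) (hermiteFun_tendsto_atTop n) hy
    linarith
  rcases le_total 0 x with hx | hx
  · exact hnonneg x hx
  · rw [← abs_hermiteFun_neg]
    exact hnonneg (-x) (by linarith)

/-- Growth of a sequence under the ladder operators of the harmonic oscillator. -/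
theorem abs_ladder_le {a : ℕ → ℝ} {C p : ℝ} (hp : 0 ≤ p)
    (ha : ∀ j : ℕ, |a j| ≤ C * (2 * (j : ℝ) + 1) ^ p) (j : ℕ) :
    |√((j : ℝ) / 2) * a (j - 1)| + |√(((j : ℝ) + 1) / 2) * a (j + 1)| ≤
      C * (1 + 3 ^ p) * (2 * (j : ℝ) + 1) ^ (p + 1 / 2) := by
  have hj : (0 : ℝ) ≤ j := j.cast_nonneg
  have hC : 0 ≤ C := by simpa using (abs_nonneg _).trans (ha 0)
  have hlam : 0 < 2 * (j : ℝ) + 1 := by positivity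
  have hdown : |a (j - 1)| ≤ C * (2 * (j : ℝ) + 1) ^ p := by
    refine (ha _).trans (mul_le_mul_of_nonneg_left ?_ hC)
    refine Real.rpow_le_rpow (by positivity) ?_ hp
    have : ((j - 1 : ℕ) : ℝ) ≤ j := Nat.cast_le.mpr (Nat.sub_le _ _)
    linarith
  have hup : |a (j + 1)| ≤ C * (3 ^ p * (2 * (j : ℝ) + 1) ^ p) := by
    refine (ha _).trans (mul_le_mul_of_nonneg_left ?_ hC)
    rw [← Real.mul_rpow (by norm_num) hlam.le]
    refine Real.rpow_le_rpow (by positivity) ?_ hp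
    push_cast
    linarith
  rw [abs_mul, abs_mul, abs_of_nonneg (Real.sqrt_nonneg _), abs_of_nonneg (Real.sqrt_nonneg _),
    Real.rpow_add hlam, ← Real.sqrt_eq_rpow]
  have h₁ : √((j : ℝ) / 2) ≤ √(2 * (j : ℝ) + 1) := Real.sqrt_le_sqrt (by linarith)
  have h₂ : √(((j : ℝ) + 1) / 2) ≤ √(2 * (j : ℝ) + 1) := Real.sqrt_le_sqrt (by linarith)
  calc _ ≤ √(2 * (j : ℝ) + 1) * (C * (2 * (j : ℝ) + 1) ^ p) +
        √(2 * (j : ℝ) + 1) * (C * (3 ^ p * (2 * (j : ℝ) + 1) ^ p)) := by gcongr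
    _ = _ := by ring

theorem iteratedDeriv_succ_hermiteFun (k n : ℕ) (x : ℝ) :
    iteratedDeriv (k + 1) (hermiteFun n) x =
      √((n : ℝ) / 2) * iteratedDeriv k (hermiteFun (n - 1)) x -
        √(((n : ℝ) + 1) / 2) * iteratedDeriv k (hermiteFun (n + 1)) x := by
  rw [iteratedDeriv_succ', deriv_hermiteFun,
    iteratedDeriv_fun_sub (contDiff_const.mul (contDiff_hermiteFun _)).contDiffAt
      (contDiff_const.mul (contDiff_hermiteFun _)).contDiffAt,
    iteratedDeriv_const_mul_field, iteratedDeriv_const_mul_field]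

theorem exists_abs_pow_mul_iteratedDeriv_hermiteFun_le (k l : ℕ) :
    ∃ C : ℝ, 0 < C ∧ ∀ (j : ℕ) (x : ℝ),
      |x ^ l * iteratedDeriv k (hermiteFun j) x| ≤
        C * (2 * (j : ℝ) + 1) ^ (((k + l : ℕ) + 1 : ℝ) / 2) := by
  induction k with
  | zero =>
    induction l with
    | zero =>
      refine ⟨4, by norm_num, fun j x => ?_⟩
      simpa [Real.sqrt_eq_rpow] using abs_hermiteFun_le j x
    | succ l ih =>
      obtain ⟨C, hC, h⟩ := ih
      refine ⟨C * (1 + 3 ^ (((0 + l : ℕ) + 1 : ℝ) / 2)), by positivity, fun j x => ?_⟩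
      have hladder := abs_ladder_le (by positivity) (fun j => h j x) j
      simp only [iteratedDeriv_zero] at hladder ⊢
      rw [show ((0 + (l + 1) : ℕ) + 1 : ℝ) / 2 = ((0 + l : ℕ) + 1 : ℝ) / 2 + 1 / 2 by
        push_cast; ring]
      refine le_trans ?_ hladder
      rw [pow_succ, mul_assoc, mul_hermiteFun, mul_add, mul_left_comm, mul_left_comm (x ^ l)]
      exact abs_add_le _ _
  | succ k ih =>
    obtain ⟨C, hC, h⟩ := ih
    refine ⟨C * (1 + 3 ^ (((k + l : ℕ) + 1 : ℝ) / 2)), by positivity, fun j x => ?_⟩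
    have hladder := abs_ladder_le (by positivity) (fun j => h j x) j
    rw [show ((k + 1 + l : ℕ) + 1 : ℝ) / 2 = ((k + l : ℕ) + 1 : ℝ) / 2 + 1 / 2 by
      push_cast; ring]
    refine le_trans ?_ hladder
    rw [iteratedDeriv_succ_hermiteFun, mul_sub, mul_left_comm, mul_left_comm (x ^ l)]
    exact abs_sub _ _

/-- Weighted uniform bounds for Hermite functions: for each `m` there is `C_m > 0` such that
`|x^ℓ (d/dx)^k φ_j(x)| ≤ C_m (2j+1)^{(m+1)/2}` for all `j`, all `k + ℓ ≤ m` and all `x`. -/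
theorem hermiteFun_weighted_bound (m : ℕ) :
    ∃ C : ℝ, 0 < C ∧ ∀ j k l : ℕ, k + l ≤ m → ∀ x : ℝ,
      |x ^ l * iteratedDeriv k (hermiteFun j) x|
        ≤ C * ((2 * (j : ℝ) + 1) ^ (((m : ℝ) + 1) / 2)) := by
  choose C hC h using exists_abs_pow_mul_iteratedDeriv_hermiteFun_le
  have hnonneg : ∀ k l, 0 ≤ C k l := fun k l => (hC k l).le
  refine ⟨1 + ∑ k ∈ Finset.range (m + 1), ∑ l ∈ Finset.range (m + 1), C k l,
    add_pos_of_pos_of_nonneg one_pos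
      (Finset.sum_nonneg fun k _ => Finset.sum_nonneg fun l _ => hnonneg k l),
    fun j k l hkl x => (h k l j x).trans ?_⟩
  have hj : (0 : ℝ) ≤ j := j.cast_nonneg
  have hkl' : ((k + l : ℕ) : ℝ) ≤ m := Nat.cast_le.mpr hkl
  have hCle : C k l ≤ ∑ k ∈ Finset.range (m + 1), ∑ l ∈ Finset.range (m + 1), C k l :=
    (Finset.single_le_sum (f := C k) (fun l _ => hnonneg k l)
      (Finset.mem_range.mpr (by omega))).trans
    (Finset.single_le_sum (f := fun k => ∑ l ∈ Finset.range (m + 1), C k l)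
      (fun k _ => Finset.sum_nonneg fun l _ => hnonneg k l) (Finset.mem_range.mpr (by omega)))
  refine mul_le_mul (by linarith) ?_ (by positivity) ((hnonneg k l).trans (by linarith))
  exact Real.rpow_le_rpow_of_exponent_le (by linarith) (by linarith)
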